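/- Let μ ∈ ℤ^n be SO_{2n+1}-dominant and let ν ∈ ℤ^n satisfy: ν_1 ≥ ν_2 ≥ ⋯ ≥ ν_n ≥ 0 (ν is SO_{2n+1}-dominant); within each of the first r batches any two entries of ν differ by at most 1, and the final batch of ν equals (1,0,…,0) or (0,…,0) (ν is M-minuscule of type B); S_i(ν_M) ≤ S_i(μ) for all 1 ≤ i ≤ n; and S_n(μ) − S_n(ν) is even. Then S_i(ν) ≤ S_i(μ) for all 1 ≤ i ≤ n, i.e. ν ≤ μ. -/

import Mathlib

open Finset

/-- `sig c k = c 0 + c 1 + ⋯ + c (k-1)`, i.e. `σ(k) = n₁ + ⋯ + n_k`. -/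
def sig (c : ℕ → ℕ) (k : ℕ) : ℕ := ∑ i ∈ Finset.range k, c i

/-- The (0-based) index of the batch containing position `i`
(positions `≥ sig c r` get index `r`, the "final batch"). -/
def batchIdx (c : ℕ → ℕ) (r i : ℕ) : ℕ :=
  Nat.findGreatest (fun k => sig c k ≤ i) r

/-- partial sum `S_i(x) = x_0 + ⋯ + x_{i-1}` (1-based: the sum of the first `i` entries). -/
def psum {α : Type*} [AddCommMonoid α] (x : ℕ → α) (i : ℕ) : α :=
  ∑ m ∈ Finset.range i, x m

/-- The batch-average vector: every entry of a batch is replaced by that batch's average;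
entries of the final batch (positions `≥ sig c r`, if any) are replaced by `0`. -/
def avgVec (c : ℕ → ℕ) (r n : ℕ) (ν : ℕ → ℤ) (i : ℕ) : ℚ :=
  if sig c r ≤ i then 0
  else (∑ m ∈ Finset.range n, if batchIdx c r m = batchIdx c r i then (ν m : ℚ) else 0) /
       (∑ m ∈ Finset.range n, if batchIdx c r m = batchIdx c r i then (1 : ℚ) else 0)

theorem sig_mono (c : ℕ → ℕ) : Monotone (sig c) := fun _ _ h =>
  Finset.sum_le_sum_of_subset (Finset.range_mono h)

theorem batchIdx_eq_iff {c : ℕ → ℕ} {r k i : ℕ} (hk : k < r) :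
    batchIdx c r i = k ↔ sig c k ≤ i ∧ i < sig c (k + 1) := by
  unfold batchIdx
  rw [Nat.findGreatest_eq_iff]
  constructor
  · rintro ⟨-, h1, h2⟩
    refine ⟨?_, not_le.mp (h2 (Nat.lt_succ_self k) hk)⟩
    rcases Nat.eq_zero_or_pos k with rfl | hk0
    · simp [sig]
    · exact h1 hk0.ne'
  · rintro ⟨h1, h2⟩
    exact ⟨hk.le, fun _ => h1, fun m hm _ => not_le.mpr (h2.trans_le (sig_mono c hm))⟩

theorem psum_eq_add_sum_Ico {α : Type*} [AddCommMonoid α] (x : ℕ → α) {a b : ℕ} (h : a ≤ b) :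
    psum x b = psum x a + ∑ m ∈ Finset.Ico a b, x m :=
  (Finset.sum_range_add_sum_Ico x h).symm

theorem avgVec_eq_of_mem_batch {c : ℕ → ℕ} {r n k i : ℕ} (ν : ℕ → ℤ) (hk : k < r)
    (hn : sig c r ≤ n) (h1 : sig c k ≤ i) (h2 : i < sig c (k + 1)) :
    avgVec c r n ν i = (∑ m ∈ Finset.Ico (sig c k) (sig c (k + 1)), (ν m : ℚ)) /
      ((Finset.Ico (sig c k) (sig c (k + 1))).card : ℚ) := by
  have hkr : sig c (k + 1) ≤ sig c r := sig_mono c hk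
  have hfilter : (Finset.range n).filter (fun m => batchIdx c r m = k) =
      Finset.Ico (sig c k) (sig c (k + 1)) := by
    ext m
    simp only [Finset.mem_filter, Finset.mem_range, Finset.mem_Ico, batchIdx_eq_iff hk]
    omega
  rw [avgVec, if_neg (by omega), (batchIdx_eq_iff hk).mpr ⟨h1, h2⟩, ← Finset.sum_filter,
    ← Finset.sum_filter, hfilter]
  simp

/-- At the end of each of the first `r` batches, averaging does not change the partial sum. -/
theorem psum_avgVec_sig {c : ℕ → ℕ} {r n : ℕ} (ν : ℕ → ℤ) (hn : sig c r ≤ n) {k : ℕ}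
    (hk : k ≤ r) : psum (avgVec c r n ν) (sig c k) = ((psum ν (sig c k) : ℤ) : ℚ) := by
  induction k with
  | zero => simp [sig, psum]
  | succ k ih =>
    have hmono := sig_mono c (Nat.le_succ k)
    rw [psum_eq_add_sum_Ico _ hmono, psum_eq_add_sum_Ico ν hmono, ih (by omega),
      Finset.sum_congr rfl fun i hi => avgVec_eq_of_mem_batch ν hk hn
        (Finset.mem_Ico.mp hi).1 (Finset.mem_Ico.mp hi).2, Finset.sum_const, nsmul_eq_mul]
    push_cast
    rcases (Finset.Ico (sig c k) (sig c (k + 1))).eq_empty_or_nonempty with h | h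
    · simp [h]
    · rw [mul_div_cancel₀ _ (by exact_mod_cast h.card_pos.ne')]

/-- On an interval where `μ` decreases and the entries of `ν` differ by at most `1`, once the
partial sums of `μ` drop below those of `ν` they stay below. -/
theorem psum_lt_psum_of_lt {μ ν : ℕ → ℤ} {a i b : ℕ} (hai : a ≤ i) (hib : i ≤ b)
    (hμ : ∀ m l, a ≤ m → m ≤ l → l < b → μ l ≤ μ m)
    (hν : ∀ m l, a ≤ m → m ≤ l → l < b → ν m ≤ ν l + 1)
    (ha : psum ν a ≤ psum μ a) (hi : psum μ i < psum ν i) : psum μ b < psum ν b := by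
  have hlt : ∑ m ∈ Finset.Ico a i, μ m < ∑ m ∈ Finset.Ico a i, ν m := by
    rw [psum_eq_add_sum_Ico μ hai, psum_eq_add_sum_Ico ν hai] at hi
    linarith
  obtain ⟨m, hm, hmlt⟩ := Finset.exists_lt_of_sum_lt hlt
  rw [Finset.mem_Ico] at hm
  have hle : ∑ l ∈ Finset.Ico i b, μ l ≤ ∑ l ∈ Finset.Ico i b, ν l := by
    refine Finset.sum_le_sum fun l hl => ?_
    rw [Finset.mem_Ico] at hl
    have h1 := hμ m l hm.1 (by omega) hl.2
    have h2 := hν m l hm.1 (by omega) hl.2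
    omega
  rw [psum_eq_add_sum_Ico μ hib, psum_eq_add_sum_Ico ν hib]
  linarith

theorem stmt9 (n r j : ℕ) (hr : 0 < r) (c : ℕ → ℕ)
    (hpos : ∀ k < r, 0 < c k) (hsum : sig c r + j = n)
    (μ ν : ℕ → ℤ)
    -- μ is SO_{2n+1}-dominant
    (hμ : (∀ i i', i ≤ i' → i' < n → μ i' ≤ μ i) ∧ 0 ≤ μ (n - 1))
    -- ν is SO_{2n+1}-dominant: ν₁ ≥ ⋯ ≥ ν_n ≥ 0
    (hν : (∀ i i', i ≤ i' → i' < n → ν i' ≤ ν i) ∧ 0 ≤ ν (n - 1))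
    -- within each of the first r batches, entries of ν differ by at most 1
    (hmin : ∀ i i', i < sig c r → i' < sig c r →
      batchIdx c r i = batchIdx c r i' → |ν i - ν i'| ≤ 1)
    -- the final batch of ν equals (0, …, 0) or (1, 0, …, 0)
    (hfin : (∀ i, sig c r ≤ i → i < n → ν i = 0) ∨
            (∀ i, sig c r ≤ i → i < n → ν i = if i = sig c r then 1 else 0))
    -- S_i(ν_M) ≤ S_i(μ) for 1 ≤ i ≤ n
    (hle : ∀ i, 1 ≤ i → i ≤ n →
      psum (avgVec c r n ν) i ≤ psum (fun m => (μ m : ℚ)) i)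
    -- S_n(μ) - S_n(ν) is even
    (hpar : Even (psum μ n - psum ν n)) :
    ∀ i, 1 ≤ i → i ≤ n → psum ν i ≤ psum μ i := by
  intro i _ hin
  have hrn : sig c r ≤ n := by omega
  have hbd : ∀ k ≤ r, psum ν (sig c k) ≤ psum μ (sig c k) := by
    intro k hk
    rcases Nat.eq_zero_or_pos (sig c k) with h0 | h0
    · simp [h0, psum]
    · have h := hle _ h0 ((sig_mono c hk).trans hrn)
      rw [psum_avgVec_sig ν hrn hk] at h
      have hcast : psum (fun m => (μ m : ℚ)) (sig c k) = ((psum μ (sig c k) : ℤ) : ℚ) := by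
        simp [psum]
      rw [hcast] at h
      exact_mod_cast h
  by_contra! hlt
  rcases lt_or_ge i (sig c r) with hir | hir
  · have hkr : batchIdx c r i < r := by
      refine lt_of_le_of_ne (Nat.findGreatest_le r) fun h => ?_
      exact absurd ((Nat.findGreatest_eq_iff.mp h).2.1 hr.ne') (not_le.mpr hir)
    obtain ⟨h1, h2⟩ := (batchIdx_eq_iff hkr).mp rfl
    have hk1 := sig_mono c (Nat.succ_le_of_lt hkr)
    refine absurd (hbd _ hkr) (not_le.mpr (psum_lt_psum_of_lt h1 h2.le
      (fun m l _ hml hl => hμ.1 m l hml (by omega)) (fun m l hm hml hl => ?_)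
      (hbd _ hkr.le) hlt))
    have hbm := (batchIdx_eq_iff hkr).mpr ⟨hm, hml.trans_lt hl⟩
    have hbl := (batchIdx_eq_iff hkr).mpr ⟨hm.trans hml, hl⟩
    have := (abs_le.mp (hmin m l (by omega) (by omega) (hbm.trans hbl.symm))).2
    omega
  · have hend : psum μ n < psum ν n := by
      refine psum_lt_psum_of_lt hir hin (fun m l _ hml hl => hμ.1 m l hml hl)
        (fun m l hm hml hl => ?_) (hbd r le_rfl) hlt
      rcases hfin with h | h
      · rw [h m hm (by omega), h l (by omega) hl]
        exact zero_le_one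
      · rw [h m hm (by omega), h l (by omega) hl]
        split_ifs <;> omega
    have hμ0 : 0 ≤ ∑ m ∈ Finset.Ico (sig c r) n, μ m := by
      refine Finset.sum_nonneg fun m hm => ?_
      rw [Finset.mem_Ico] at hm
      exact hμ.2.trans (hμ.1 m (n - 1) (by omega) (by omega))
    have hν1 : ∑ m ∈ Finset.Ico (sig c r) n, ν m ≤ 1 := by
      rcases hfin with h | h
      · rw [Finset.sum_eq_zero fun m hm => h m (Finset.mem_Ico.mp hm).1 (Finset.mem_Ico.mp hm).2]
        exact zero_le_one
      · rw [Finset.sum_congr rfl fun m hm =>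
          h m (Finset.mem_Ico.mp hm).1 (Finset.mem_Ico.mp hm).2, Finset.sum_ite_eq']
        split_ifs <;> omega
    have hbr := hbd r le_rfl
    have e1 := psum_eq_add_sum_Ico μ hrn
    have e2 := psum_eq_add_sum_Ico ν hrn
    obtain ⟨t, ht⟩ := hpar
    omega
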